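/- Let G be a finite abelian group, let B and B' be Bohr systems on G, and let λ ∈ (0,1]. Then: (i) dim(B ∧ B') ≤ dim B + dim B'; (ii) dim(λB) ≤ dim B; (iii) dim* B ≤ dim B ≤ 2·dim* B. -/

import Mathlib

open scoped BigOperators Pointwise ENNReal ENat
open Real

namespace Paper

noncomputable section

/-- For `z` on the unit circle, `circNorm z = min {|θ| : z = exp(2πiθ)}`. -/
def circNorm (z : ℂ) : ℝ := |z.arg| / (2 * Real.pi)

variable {G : Type} [AddCommGroup G]

/-- The (generalised) Bohr set with frequency set `Γ` and width function `δ`. -/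
def bohrSet (Γ : Set (AddChar G ℂ)) (δ : AddChar G ℂ → ℝ) : Set G :=
  {x | ∀ γ ∈ Γ, circNorm (γ x) < δ γ}

/-- `(Γ, δ)` generates the family of sets `F` as a Bohr system. -/
def IsBohrGen (Γ : Set (AddChar G ℂ)) (δ : AddChar G ℂ → ℝ) (F : ℝ → Set G) : Prop :=
  (∀ γ ∈ Γ, 0 < δ γ) ∧ ∀ η : ℝ, 0 < η → η ≤ 1 → F η = bohrSet Γ (fun γ => η * δ γ)

/-- A Bohr system: a family `(B_η)_{η ∈ (0,1]}` of subsets of `G` of the form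
`B_η = Bohr(Γ, ηδ)` for some generating pair `(Γ, δ)`. -/
structure BohrSystem (G : Type) [AddCommGroup G] where
  sets : ℝ → Set G
  exists_gen : ∃ Γ δ, IsBohrGen Γ δ sets

/-- The covering number `C(S;T) = min {|X| : S ⊆ X + T}`, valued in `ℕ∞`. -/
def coveringNumber {H : Type} [AddCommGroup H] (S T : Set H) : ℕ∞ :=
  sInf {n : ℕ∞ | ∃ X : Finset H, (X.card : ℕ∞) = n ∧ S ⊆ (X : Set H) + T}

/-- Auxiliary quantity for the difference covering number, for a fixed target group `H`. -/
def dCovAux (S T : Set G) (H : Type) [AddCommGroup H] : ℕ∞ :=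
  ⨅ (φ : G →+ H) (U : Set H) (V : Set H) (_ : S ⊆ φ ⁻¹' U) (_ : φ ⁻¹' (V - V) ⊆ T),
    coveringNumber U V

/-- The difference covering number `C^Δ(S;T)`: the infimum of `C_H(U;V)` over all abelian
groups `H`, homomorphisms `φ : G → H` and sets `U, V ⊆ H` with `S ⊆ φ⁻¹(U)` and
`φ⁻¹(V − V) ⊆ T`. -/
def dCoveringNumber (S T : Set G) : ℕ∞ :=
  ⨅ (H : Type) (inst : AddCommGroup H), @dCovAux G _ S T H inst

/-- Interpret an extended natural number as a real number. -/
def enatReal (n : ℕ∞) : ℝ := (n.toNat : ℝ)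

/-- The dimension of a family of sets: `sup {log₂ C^Δ(F_η; F_{η/2}) : η ∈ (0,1]}`. -/
def dimOfSets (F : ℝ → Set G) : ℝ :=
  sSup {r : ℝ | ∃ η : ℝ, 0 < η ∧ η ≤ 1 ∧
    r = Real.logb 2 (enatReal (dCoveringNumber (F η) (F (η / 2))))}

/-- The dimension `dim B` of a Bohr system. -/
def BohrSystem.dim (B : BohrSystem G) : ℝ := dimOfSets B.sets

/-- The doubling dimension of a family of sets:
`sup {log₂ C(F_η; F_{η/2}) : η ∈ (0,1]}`. -/
def dimStarOfSets (F : ℝ → Set G) : ℝ :=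
  sSup {r : ℝ | ∃ η : ℝ, 0 < η ∧ η ≤ 1 ∧
    r = Real.logb 2 (enatReal (coveringNumber (F η) (F (η / 2))))}

/-- The doubling dimension `dim* B` of a Bohr system. -/
def BohrSystem.dimStar (B : BohrSystem G) : ℝ := dimStarOfSets B.sets

/-- `B' ≤ B` for Bohr systems, i.e. `B' ∧ B = B'`, i.e. `B'_η ⊆ B_η` for all `η ∈ (0,1]`. -/
def BohrSystem.le (B' B : BohrSystem G) : Prop :=
  ∀ η : ℝ, 0 < η → η ≤ 1 → B'.sets η ⊆ B.sets η

/-- The width of a Bohr system: `inf {‖δ‖_{ℓ∞(Γ)} : (Γ,δ) generates B}`. -/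
def BohrSystem.width (B : BohrSystem G) : ℝ :=
  sInf {r : ℝ | ∃ Γ δ, IsBohrGen Γ δ B.sets ∧ r = sSup (δ '' Γ)}

/-- The `n`-fold sumset `nS = S + ⋯ + S`. -/
def iterSum : ℕ → Set G → Set G
  | 0, _ => {0}
  | n + 1, S => S + iterSum n S

/-- The set of all cosets of subgroups of `G`. -/
def cosets (G : Type) [AddCommGroup G] : Set (Set G) :=
  {W | ∃ (H : AddSubgroup G) (x : G), W = (fun h => x + h) '' (H : Set G)}

/-- The set of cosets of a fixed subgroup `H` of `G`. -/
def cosetsOf (H : AddSubgroup G) : Set (Set G) :=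
  {W | ∃ x : G, W = (fun h => x + h) '' (H : Set G)}

/-- `f` is `ε`-almost integer-valued, with integer part `fZ`. -/
def AlmostInt (ε : ℝ) (f : G → ℂ) (fZ : G → ℤ) : Prop :=
  ∀ x, ‖f x - (fZ x : ℂ)‖ ≤ ε

/-- The `ρ`-approximate annihilator `N(S,ρ)` of a set `S ⊆ G`. -/
def annihilator (S : Set G) (ρ : ℝ) : Set (AddChar G ℂ) :=
  {γ | ∀ x ∈ S, ‖(1 : ℂ) - γ x‖ < ρ}

/-- `A` is `(m,l)`-arithmetically connected. -/
def ArithConnected (m l : ℕ) (A : Set G) : Prop :=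
  ∀ x : Fin m → G, (∀ i, x i ∈ A) →
    ∃ σ : Fin m → ℤ, (∑ i, (σ i).natAbs) ≤ l ∧
      (∃ i j, i ≠ j ∧ (σ i).natAbs = 1 ∧ (σ j).natAbs = 1) ∧
      (∑ i, σ i • x i) ∈ A

variable [Fintype G]

/-- The Haar probability measure of a subset of the finite group `G`. -/
def haar (S : Set G) : ℝ := (Nat.card S : ℝ) / (Fintype.card G : ℝ)

/-- A probability measure on the finite group `G`, given by its weight function. -/
def IsProb (w : G → ℝ) : Prop := (∀ x, 0 ≤ w x) ∧ ∑ x, w x = 1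

/-- The measure of `S` under the weight function `w`. -/
def wMeasure (w : G → ℝ) (S : Set G) : ℝ := ∑ x, S.indicator w x

/-- The probability measure `μ_S`: `μ` restricted to `S` and normalised. -/
def restrictProb (w : G → ℝ) (S : Set G) : G → ℝ :=
  fun x => S.indicator w x / wMeasure w S

/-- The probability measure `w` is `F`-approximately invariant: for every `η ∈ (0,1]` there
are probability measures `w⁺, w⁻` with `(1−η)·w⁻ ≤ τ_x(w) ≤ (1+η)·w⁺` for all `x ∈ F η`. -/
def ApproxInvariant (F : ℝ → Set G) (w : G → ℝ) : Prop :=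
  ∀ η : ℝ, 0 < η → η ≤ 1 → ∃ wp wm : G → ℝ, IsProb wp ∧ IsProb wm ∧
    ∀ x ∈ F η, ∀ y : G, (1 - η) * wm y ≤ w (y - x) ∧ w (y - x) ≤ (1 + η) * wp y

/-- The Fourier coefficient `f̂(γ) = (1/|G|) ∑_x f(x) conj(γ(x))`. -/
def fourierCoeff (f : G → ℂ) (γ : AddChar G ℂ) : ℂ :=
  (Fintype.card G : ℂ)⁻¹ * ∑ x, f x * (starRingEnd ℂ) (γ x)

/-- The Wiener norm `‖f‖_{A(G)} = ∑_γ |f̂(γ)|`. -/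
def wienerNorm (f : G → ℂ) : ℝ := ∑ᶠ γ : AddChar G ℂ, ‖fourierCoeff f γ‖

/-- The Fourier transform `μ̂(γ) = ∫ conj(γ(x)) dμ(x)` of a measure with weight `w`. -/
def fourierWeight (w : G → ℝ) (γ : AddChar G ℂ) : ℂ :=
  ∑ x, (starRingEnd ℂ) (γ x) * (w x : ℂ)

/-- Convolution `f ∗ μ (x) = ∫ f(x−y) dμ(y)` of a complex function with a measure. -/
def convC (f : G → ℂ) (w : G → ℝ) (x : G) : ℂ := ∑ y, f (x - y) * (w y : ℂ)

/-- Convolution `f ∗ μ (x) = ∫ f(x−y) dμ(y)` of a real function with a measure. -/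
def convR (f : G → ℝ) (w : G → ℝ) (x : G) : ℝ := ∑ y, f (x - y) * w y

/-- Convolution of functions w.r.t. Haar measure: `f ∗ g (x) = (1/|G|) ∑_y f(y) g(x−y)`. -/
def convFun (f g : G → ℝ) (x : G) : ℝ := (Fintype.card G : ℝ)⁻¹ * ∑ y, f y * g (x - y)

/-- The `L_p` norm `(∫ |f|^p dν)^{1/p}` w.r.t. the measure with weight `w`. -/
def LpW (p : ℝ) (w : G → ℝ) (f : G → ℂ) : ℝ := (∑ y, w y * ‖f y‖ ^ p) ^ (1 / p)

/-- `X` has relative polynomial growth of order `d`. -/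
def HasRPG (X : Set G) (d : ℝ) : Prop :=
  ∀ n : ℕ, 1 ≤ n → haar (iterSum n X) ≤ (n : ℝ) ^ d * haar X

end

section Helpers

theorem cov_le {H : Type} [AddCommGroup H] {S T : Set H} (X : Finset H)
    (h : S ⊆ (X : Set H) + T) : coveringNumber S T ≤ X.card :=
  sInf_le ⟨X, rfl, h⟩

theorem cov_exists {H : Type} [AddCommGroup H] {S T : Set H} {n : ℕ∞}
    (h : coveringNumber S T < n) :
    ∃ X : Finset H, (X.card : ℕ∞) < n ∧ S ⊆ (X : Set H) + T := by
  obtain ⟨m, ⟨X, hX, hS⟩, hm⟩ := sInf_lt_iff.1 h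
  exact ⟨X, hX ▸ hm, hS⟩

theorem dcov_le {G : Type} [AddCommGroup G] {S T : Set G} {H : Type} [inst : AddCommGroup H]
    (φ : G →+ H) (X : Finset H) (V : Set H)
    (hS : S ⊆ φ ⁻¹' ((X : Set H) + V)) (hT : φ ⁻¹' (V - V) ⊆ T) :
    dCoveringNumber S T ≤ X.card := by
  refine le_trans (iInf_le_of_le H (iInf_le_of_le inst (iInf_le_of_le φ
    (iInf_le_of_le ((X : Set H) + V) (iInf_le_of_le V (iInf_le_of_le hS
      (iInf_le_of_le hT le_rfl))))))) (cov_le X subset_rfl)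

theorem dcov_exists {G : Type} [AddCommGroup G] {S T : Set G} {n : ℕ∞}
    (h : dCoveringNumber S T < n) :
    ∃ (H : Type) (_ : AddCommGroup H) (φ : G →+ H) (X : Finset H) (V : Set H),
      (X.card : ℕ∞) < n ∧ S ⊆ φ ⁻¹' ((X : Set H) + V) ∧ φ ⁻¹' (V - V) ⊆ T := by
  unfold dCoveringNumber dCovAux at h
  simp only [iInf_lt_iff] at h
  obtain ⟨H, inst, φ, U, V, hS, hT, h⟩ := h
  obtain ⟨X, hX, hU⟩ := cov_exists h
  exact ⟨H, inst, φ, X, V, hX, hS.trans (Set.preimage_mono hU), hT⟩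

variable {G : Type} [AddCommGroup G] [Fintype G]

theorem cov_le_card {S T : Set G} (h0 : (0 : G) ∈ T) :
    coveringNumber S T ≤ Fintype.card G := by
  refine cov_le Finset.univ fun x _ => ?_
  exact ⟨x, by simp, 0, h0, by simp⟩

theorem dcov_le_card {S T : Set G} (h0 : (0 : G) ∈ T) :
    dCoveringNumber S T ≤ Fintype.card G := by
  refine dcov_le (AddMonoidHom.id G) Finset.univ {0} (fun x _ => ?_) ?_
  · exact ⟨x, by simp, 0, by simp, by simp⟩
  · intro x hx
    simp at hx
    exact hx ▸ h0

theorem cov_toNat_le_card {S T : Set G} (h0 : (0 : G) ∈ T) :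
    (coveringNumber S T).toNat ≤ Fintype.card G :=
  ENat.toNat_le_of_le_natCast (cov_le_card h0)

theorem dcov_toNat_le_card {S T : Set G} (h0 : (0 : G) ∈ T) :
    (dCoveringNumber S T).toNat ≤ Fintype.card G :=
  ENat.toNat_le_of_le_natCast (dcov_le_card h0)

theorem cov_nat_exists {S T : Set G} (h0 : (0 : G) ∈ T) :
    ∃ X : Finset G, X.card ≤ (coveringNumber S T).toNat ∧ S ⊆ (X : Set G) + T := by
  have hne : coveringNumber S T ≠ ⊤ := ne_top_of_le_ne_top (ENat.natCast_ne_top _) (cov_le_card h0)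
  have : coveringNumber S T < (((coveringNumber S T).toNat + 1 : ℕ) : ℕ∞) := by
    conv_lhs => rw [← ENat.natCast_toNat hne]
    exact_mod_cast Nat.lt_succ_self _
  obtain ⟨X, hX, hS⟩ := cov_exists this
  exact ⟨X, Nat.lt_succ_iff.1 (by exact_mod_cast hX), hS⟩

theorem dcov_nat_exists {S T : Set G} (h0 : (0 : G) ∈ T) :
    ∃ (H : Type) (_ : AddCommGroup H) (φ : G →+ H) (X : Finset H) (V : Set H),
      X.card ≤ (dCoveringNumber S T).toNat ∧
        S ⊆ φ ⁻¹' ((X : Set H) + V) ∧ φ ⁻¹' (V - V) ⊆ T := by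
  have hne : dCoveringNumber S T ≠ ⊤ := ne_top_of_le_ne_top (ENat.natCast_ne_top _) (dcov_le_card h0)
  have : dCoveringNumber S T < (((dCoveringNumber S T).toNat + 1 : ℕ) : ℕ∞) := by
    conv_lhs => rw [← ENat.natCast_toNat hne]
    exact_mod_cast Nat.lt_succ_self _
  obtain ⟨H, i, φ, X, V, hX, hS, hT⟩ := dcov_exists this
  exact ⟨H, i, φ, X, V, Nat.lt_succ_iff.1 (by exact_mod_cast hX), hS, hT⟩

theorem cov_pos {S T : Set G} (hS : S.Nonempty) (h0 : (0 : G) ∈ T) :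
    0 < (coveringNumber S T).toNat := by
  obtain ⟨X, hX, hc⟩ := cov_nat_exists (S := S) h0
  obtain ⟨s, hs⟩ := hS
  obtain ⟨x, hx, -⟩ := hc hs
  exact lt_of_lt_of_le (Finset.card_pos.2 ⟨x, hx⟩) hX

theorem dcov_pos {S T : Set G} (hS : S.Nonempty) (h0 : (0 : G) ∈ T) :
    0 < (dCoveringNumber S T).toNat := by
  obtain ⟨H, i, φ, X, V, hX, hc, -⟩ := dcov_nat_exists (S := S) h0
  obtain ⟨s, hs⟩ := hS
  obtain ⟨x, hx, -⟩ := hc hs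
  exact lt_of_lt_of_le (Finset.card_pos.2 ⟨x, hx⟩) hX

theorem dcov_inter {S T S' T' : Set G} (h0 : (0 : G) ∈ T) (h0' : (0 : G) ∈ T') :
    (dCoveringNumber (S ∩ S') (T ∩ T')).toNat ≤
      (dCoveringNumber S T).toNat * (dCoveringNumber S' T').toNat := by
  obtain ⟨H, i, φ, X, V, hX, hS, hT⟩ := dcov_nat_exists (S := S) h0
  obtain ⟨H', i', φ', X', V', hX', hS', hT'⟩ := dcov_nat_exists (S := S') h0'
  refine le_trans ?_ (Nat.mul_le_mul hX hX')
  rw [← Finset.card_product]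
  refine ENat.toNat_le_of_le_natCast (dcov_le (φ.prod φ') (X ×ˢ X') (V ×ˢ V') ?_ ?_)
  · rintro x ⟨hx, hx'⟩
    obtain ⟨a, ha, b, hb, hab⟩ := hS hx
    obtain ⟨a', ha', b', hb', hab'⟩ := hS' hx'
    refine ⟨(a, a'), ?_, (b, b'), ⟨hb, hb'⟩, Prod.ext hab hab'⟩
    simpa using ⟨ha, ha'⟩
  · rintro x ⟨⟨a, a'⟩, ⟨ha, ha'⟩, ⟨b, b'⟩, ⟨hb, hb'⟩, h⟩
    have h := Prod.ext_iff.1 h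
    exact ⟨hT ⟨a, ha, b, hb, h.1⟩, hT' ⟨a', ha', b', hb', h.2⟩⟩

theorem cov_le_dcov {S T : Set G} (h0 : (0 : G) ∈ T) :
    (coveringNumber S T).toNat ≤ (dCoveringNumber S T).toNat := by
  classical
  obtain ⟨H, i, φ, X, V, hX, hS, hT⟩ := dcov_nat_exists (S := S) h0
  refine le_trans ?_ hX
  let f : H → G := fun x => if h : ∃ s, φ s - x ∈ V then h.choose else 0
  refine le_trans (ENat.toNat_le_of_le_natCast (cov_le (X.image f) ?_)) Finset.card_image_le
  intro s hs
  obtain ⟨x, hx, v, hv, hxv⟩ := hS hs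
  have hxv : x + v = φ s := hxv
  have hex : ∃ s, φ s - x ∈ V := ⟨s, by rw [← hxv]; simpa using hv⟩
  have hf : φ (f x) - x ∈ V := by
    simp only [f, dif_pos hex]
    exact hex.choose_spec
  refine ⟨f x, by simpa using ⟨x, hx, rfl⟩, s - f x, hT ⟨v, hv, φ (f x) - x, hf, ?_⟩, by simp⟩
  simp only [map_sub, ← hxv]
  abel

theorem dcov_le_mul {S T W : Set G} (hT : (0 : G) ∈ T) (hW : (0 : G) ∈ W)
    (hWT : W - W ⊆ T) :
    (dCoveringNumber S T).toNat ≤ (coveringNumber S T).toNat * (coveringNumber T W).toNat := by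
  classical
  obtain ⟨X, hX, hS⟩ := cov_nat_exists (S := S) hT
  obtain ⟨Y, hY, hS'⟩ := cov_nat_exists (S := T) hW
  refine le_trans ?_ (Nat.mul_le_mul hX hY)
  refine le_trans (ENat.toNat_le_of_le_natCast
    (dcov_le (AddMonoidHom.id G) (X + Y) W ?_ ?_)) Finset.card_add_le
  · intro s hs
    obtain ⟨x, hx, t, ht, rfl⟩ := hS hs
    obtain ⟨y, hy, w, hw, rfl⟩ := hS' ht
    exact ⟨x + y, by push_cast; exact Set.add_mem_add hx hy, w, hw, add_assoc _ _ _⟩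
  · exact hWT

theorem abs_arg_mul_le {z w : ℂ} (hz : z ≠ 0) (hw : w ≠ 0) :
    |(z * w).arg| ≤ |z.arg| + |w.arg| := by
  by_cases h : |z.arg| + |w.arg| < Real.pi
  · rw [Complex.arg_mul hz hw]
    · exact abs_add_le _ _
    · have := abs_lt.1 (lt_of_le_of_lt (abs_add_le _ _) h)
      exact ⟨this.1, this.2.le⟩
  · exact (Complex.abs_arg_le_pi _).trans (not_lt.1 h)

theorem circNorm_sub_le (γ : AddChar G ℂ) (x y : G) :
    circNorm (γ (x - y)) ≤ circNorm (γ x) + circNorm (γ y) := by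
  have h : |(γ (x - y)).arg| ≤ |(γ x).arg| + |(γ y).arg| := by
    have hn : |(γ (-y)).arg| = |(γ y).arg| := by
      rw [AddChar.map_neg_eq_inv, Complex.abs_arg_inv]
    rw [sub_eq_add_neg, AddChar.map_add_eq_mul, ← hn]
    exact abs_arg_mul_le ((γ.val_isUnit x).ne_zero) ((γ.val_isUnit _).ne_zero)
  unfold circNorm
  rw [← add_div]
  exact div_le_div_of_nonneg_right h (by positivity)

theorem zero_mem_sets (B : BohrSystem G) {η : ℝ} (h0 : 0 < η) (h1 : η ≤ 1) :
    (0 : G) ∈ B.sets η := by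
  obtain ⟨Γ, δ, hδ, h⟩ := B.exists_gen
  rw [h η h0 h1]
  intro γ hγ
  simpa [circNorm] using mul_pos h0 (hδ γ hγ)

theorem sub_sets (B : BohrSystem G) {η : ℝ} (h0 : 0 < η) (h1 : η ≤ 1) :
    B.sets (η / 2) - B.sets (η / 2) ⊆ B.sets η := by
  obtain ⟨Γ, δ, hδ, h⟩ := B.exists_gen
  rw [h η h0 h1, h (η / 2) (by positivity) (by linarith)]
  rintro _ ⟨x, hx, y, hy, rfl⟩ γ hγ
  have := circNorm_sub_le γ x y
  have hx := hx γ hγ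
  have hy := hy γ hγ
  simp only at hx hy ⊢
  linarith

theorem logb_mono {m n : ℕ} (hm : 0 < m) (h : m ≤ n) :
    Real.logb 2 (m : ℝ) ≤ Real.logb 2 n :=
  Real.logb_le_logb_of_le (by norm_num) (by exact_mod_cast hm) (by exact_mod_cast h)

theorem le_dim (B : BohrSystem G) {η : ℝ} (h0 : 0 < η) (h1 : η ≤ 1) :
    Real.logb 2 ((dCoveringNumber (B.sets η) (B.sets (η / 2))).toNat : ℝ) ≤ B.dim := by
  refine le_csSup ⟨Real.logb 2 (Fintype.card G), ?_⟩ ⟨η, h0, h1, rfl⟩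
  rintro _ ⟨η, h0, h1, rfl⟩
  have := zero_mem_sets B (half_pos h0) (by linarith)
  exact logb_mono (dcov_pos ⟨0, zero_mem_sets B h0 h1⟩ this) (dcov_toNat_le_card this)

theorem le_dimStar (B : BohrSystem G) {η : ℝ} (h0 : 0 < η) (h1 : η ≤ 1) :
    Real.logb 2 ((coveringNumber (B.sets η) (B.sets (η / 2))).toNat : ℝ) ≤ B.dimStar := by
  refine le_csSup ⟨Real.logb 2 (Fintype.card G), ?_⟩ ⟨η, h0, h1, rfl⟩
  rintro _ ⟨η, h0, h1, rfl⟩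
  have := zero_mem_sets B (half_pos h0) (by linarith)
  exact logb_mono (cov_pos ⟨0, zero_mem_sets B h0 h1⟩ this) (cov_toNat_le_card this)

theorem logb_le_add {a m n : ℕ} (ha : 0 < a) (hm : 0 < m) (hn : 0 < n) (h : a ≤ m * n) :
    Real.logb 2 (a : ℝ) ≤ Real.logb 2 m + Real.logb 2 n := by
  rw [← Real.logb_mul (by positivity) (by positivity)]
  exact_mod_cast logb_mono ha h

end Helpers

/-- Lemma 3.4, basic properties of dimension. -/
theorem statement19 :
    ∀ (G : Type) [AddCommGroup G] [Fintype G],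
      ∀ (B B' : BohrSystem G) (lam : ℝ), 0 < lam → lam ≤ 1 →
        dimOfSets (fun η => B.sets η ∩ B'.sets η) ≤ B.dim + B'.dim ∧
        dimOfSets (fun η => B.sets (lam * η)) ≤ B.dim ∧
        B.dimStar ≤ B.dim ∧ B.dim ≤ 2 * B.dimStar := by
  intro G _ _ B B' lam hl0 hl1
  refine ⟨?_, ?_, ?_, ?_⟩
  · refine csSup_le ⟨_, 1, one_pos, le_rfl, rfl⟩ ?_
    rintro _ ⟨η, h0, h1, rfl⟩
    have a := zero_mem_sets B h0 h1
    have b := zero_mem_sets B (half_pos h0) (by linarith)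
    have a' := zero_mem_sets B' h0 h1
    have b' := zero_mem_sets B' (half_pos h0) (by linarith)
    exact (logb_le_add (dcov_pos (S := B.sets η ∩ B'.sets η)
      (T := B.sets (η / 2) ∩ B'.sets (η / 2)) ⟨0, a, a'⟩ ⟨b, b'⟩) (dcov_pos ⟨0, a⟩ b) (dcov_pos ⟨0, a'⟩ b')
      (dcov_inter b b')).trans (add_le_add (le_dim B h0 h1) (le_dim B' h0 h1))
  · refine csSup_le ⟨_, 1, one_pos, le_rfl, rfl⟩ ?_
    rintro _ ⟨η, h0, h1, rfl⟩
    have := le_dim B (mul_pos hl0 h0) (mul_le_one₀ hl1 h0.le h1)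
    rwa [mul_div_assoc] at this
  · refine csSup_le ⟨_, 1, one_pos, le_rfl, rfl⟩ ?_
    rintro _ ⟨η, h0, h1, rfl⟩
    have a := zero_mem_sets B h0 h1
    have b := zero_mem_sets B (half_pos h0) (by linarith)
    exact (logb_mono (cov_pos ⟨0, a⟩ b) (cov_le_dcov b)).trans (le_dim B h0 h1)
  · refine csSup_le ⟨_, 1, one_pos, le_rfl, rfl⟩ ?_
    rintro _ ⟨η, h0, h1, rfl⟩
    have h2 : 0 < η / 2 := half_pos h0
    have h3 : η / 2 ≤ 1 := by linarith
    have a := zero_mem_sets B h0 h1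
    have b := zero_mem_sets B h2 h3
    have c := zero_mem_sets B (half_pos h2) (by linarith)
    rw [two_mul]
    exact (logb_le_add (dcov_pos ⟨0, a⟩ b) (cov_pos ⟨0, a⟩ b) (cov_pos ⟨0, b⟩ c)
      (dcov_le_mul b c (sub_sets B h2 h3))).trans
      (add_le_add (le_dimStar B h0 h1) (le_dimStar B h2 h3))

end Paper
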